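/- arXiv:1510.04491 — 3 statements merged into one kernel-verified Lean document; each statement's English description precedes it below -/
import Mathlib

section
/- Let ψ be a flow on a metric space (X,d) such that ψ_t is Lipschitz continuous for every t ≥ 0, uniformly for t in compact subsets of [0,+∞). If a point x ∈ X is not strongly chain recurrent, then there exists a Lipschitz continuous Lyapunov function h : X → ℝ for ψ such that x does not belong to the neutral set N(h). -/
/-- A (continuous) flow on a metric space. -/
def IsFlow {X : Type*} [MetricSpace X] (ψ : ℝ → X → X) : Prop :=
  Continuous (fun p : ℝ × X => ψ p.1 p.2) ∧ (∀ x, ψ 0 x = x) ∧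
    ∀ t s x, ψ (t + s) x = ψ t (ψ s x)

/-- There is a strong `(ε,T)`-chain from `a` to `b`: a finite sequence
`(x_i, t_i)`, `i = 1, …, n` with `t_i ≥ T`, `x_1 = a`, `x_{n+1} = b`, and
`∑ d(ψ_{t_i}(x_i), x_{i+1}) < ε`. -/
def HasStrongChain {X : Type*} [MetricSpace X] (ψ : ℝ → X → X) (ε T : ℝ) (a b : X) : Prop :=
  ∃ (n : ℕ) (x : Fin (n + 1) → X) (t : Fin n → ℝ), 0 < n ∧ (∀ i, T ≤ t i) ∧
    x 0 = a ∧ x (Fin.last n) = b ∧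
    (∑ i : Fin n, dist (ψ (t i) (x i.castSucc)) (x i.succ)) < ε

/-- A strongly chain recurrent point. -/
def StronglyChainRecurrentPt {X : Type*} [MetricSpace X] (ψ : ℝ → X → X) (x : X) : Prop :=
  ∀ ε > 0, ∀ T ≥ (0 : ℝ), HasStrongChain ψ ε T x x

/-- A Lyapunov function for the flow `ψ`. -/
def IsLyapunov {X : Type*} [MetricSpace X] (ψ : ℝ → X → X) (h : X → ℝ) : Prop :=
  ∀ t ≥ (0 : ℝ), ∀ x, h (ψ t x) ≤ h x

/-- The neutral set of a Lyapunov function. -/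
def NeutralSet {X : Type*} [MetricSpace X] (ψ : ℝ → X → X) (h : X → ℝ) : Set X :=
  {x | ∀ t : ℝ, h (ψ t x) = h x}

/-- A first integral for the flow `ψ`. -/
def IsFirstIntegral {X : Type*} [MetricSpace X] (ψ : ℝ → X → X) (h : X → ℝ) : Prop :=
  ∀ (t : ℝ) (x : X), h (ψ t x) = h x

/-- `ψ_t` is Lipschitz for every `t ≥ 0`, uniformly for `t` in compact subsets
of `[0, +∞)`. -/
def UniformlyLipschitzTimeMaps {X : Type*} [MetricSpace X] (ψ : ℝ → X → X) : Prop :=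
  ∀ T ≥ (0 : ℝ), ∃ C : NNReal, ∀ t ∈ Set.Icc 0 T, LipschitzWith C (ψ t)

/-- The flow `ψ` is strongly chain transitive. -/
def StronglyChainTransitive {X : Type*} [MetricSpace X] (ψ : ℝ → X → X) : Prop :=
  ∀ x y : X, ∀ ε > 0, ∀ T ≥ (0 : ℝ), HasStrongChain ψ ε T x y

section Chains

variable {X : Type*} [MetricSpace X] {ψ : ℝ → X → X} {ε T t : ℝ} {a b c : X}

theorem HasStrongChain.pos (h : HasStrongChain ψ ε T a b) : 0 < ε := by
  obtain ⟨n, x, t, -, -, -, -, h⟩ := h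
  exact (Finset.sum_nonneg fun _ _ => dist_nonneg).trans_lt h

theorem hasStrongChain_single (ht : T ≤ t) (h : dist (ψ t a) b < ε) :
    HasStrongChain ψ ε T a b :=
  ⟨1, ![a, b], fun _ => t, one_pos, fun _ => ht, rfl, rfl, by simpa using h⟩

theorem HasStrongChain.change_endpoint (h : HasStrongChain ψ ε T a b) (c : X) :
    HasStrongChain ψ (ε + dist b c) T a c := by
  obtain ⟨n, x, t, hn, ht, ha, hb, h⟩ := h
  obtain ⟨m, rfl⟩ : ∃ m, n = m + 1 := ⟨n - 1, by omega⟩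
  refine ⟨m + 1, Fin.snoc (fun i : Fin (m + 1) => x i.castSucc) c, t, hn, ht, ?_, ?_, ?_⟩
  · rw [← Fin.castSucc_zero, Fin.snoc_castSucc]
    exact ha
  · rw [Fin.snoc_last]
  · rw [Fin.sum_univ_castSucc] at h ⊢
    simp only [Fin.snoc_castSucc, Fin.succ_castSucc, Fin.succ_last, Fin.snoc_last] at h ⊢
    rw [hb] at h
    have := dist_triangle (ψ (t (Fin.last m)) (x (Fin.last m).castSucc)) b c
    linarith

theorem HasStrongChain.flow_endpoint (h : HasStrongChain ψ ε T a b) (hT : T ≤ t) :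
    HasStrongChain ψ ε T a (ψ t b) := by
  obtain ⟨n, x, s, hn, hs, ha, hb, h⟩ := h
  refine ⟨n + 1, Fin.snoc x (ψ t b), Fin.snoc s t, n.succ_pos, ?_, ?_, ?_, ?_⟩
  · refine Fin.lastCases ?_ fun i => ?_
    · simpa using hT
    · simpa using hs i
  · rw [← Fin.castSucc_zero, Fin.snoc_castSucc]
    exact ha
  · rw [Fin.snoc_last]
  · rw [Fin.sum_univ_castSucc]
    simp only [Fin.snoc_castSucc, Fin.succ_castSucc, Fin.succ_last, Fin.snoc_last, hb, dist_self,
      add_zero]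
    exact h

/-- The infimal cost of a strong chain from `a` to `b` with times at least `T`. -/
noncomputable def chainCost (ψ : ℝ → X → X) (T : ℝ) (a b : X) : ℝ :=
  sInf {ε | HasStrongChain ψ ε T a b}

theorem bddBelow_chainCost : BddBelow {ε | HasStrongChain ψ ε T a b} :=
  ⟨0, fun _ h => h.pos.le⟩

theorem nonempty_chainCost : {ε | HasStrongChain ψ ε T a b}.Nonempty :=
  ⟨dist (ψ T a) b + 1, hasStrongChain_single le_rfl (lt_add_one _)⟩

theorem chainCost_le (h : HasStrongChain ψ ε T a b) : chainCost ψ T a b ≤ ε :=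
  csInf_le bddBelow_chainCost h

theorem lipschitzWith_chainCost : LipschitzWith 1 (chainCost ψ T a) := by
  refine LipschitzWith.of_le_add fun c b => ?_
  rw [← sub_le_iff_le_add]
  refine le_csInf nonempty_chainCost fun ε h => ?_
  rw [sub_le_iff_le_add, dist_comm]
  exact chainCost_le (h.change_endpoint c)

theorem chainCost_flow_le (hT : T ≤ t) : chainCost ψ T a (ψ t b) ≤ chainCost ψ T a b :=
  le_csInf nonempty_chainCost fun _ h => chainCost_le (h.flow_endpoint hT)

theorem chainCost_self_flow (hT : T ≤ t) : chainCost ψ T a (ψ t a) ≤ 0 :=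
  le_of_forall_pos_le_add fun ε hε =>
    chainCost_le (hasStrongChain_single hT (by simpa using hε))

end Chains

/-- Taking the supremum along forward orbits turns a Lipschitz function which is nonincreasing
under `ψ t` for large `t` into a Lipschitz Lyapunov function. -/
theorem exists_lipschitz_lyapunov_of_eventually_nonincreasing {X : Type*} [MetricSpace X]
    {ψ : ℝ → X → X} (hψ : IsFlow ψ) (hLip : UniformlyLipschitzTimeMaps ψ) {T : ℝ} (hT : 0 ≤ T)
    {g : X → ℝ} (hg : LipschitzWith 1 g) (hdecr : ∀ t ≥ T, ∀ y, g (ψ t y) ≤ g y) :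
    ∃ h : X → ℝ, (∃ K : NNReal, LipschitzWith K h) ∧ IsLyapunov ψ h ∧ (∀ y, g y ≤ h y) ∧
      ∀ y r, (∀ t ≥ (0 : ℝ), g (ψ t y) ≤ r) → h y ≤ r := by
  obtain ⟨hcont, h0, hadd⟩ := hψ
  have hbdd (y : X) : BddAbove (Set.range fun s : Set.Ici (0 : ℝ) => g (ψ s y)) := by
    have hc : Continuous fun s : ℝ => g (ψ s y) :=
      hg.continuous.comp (hcont.comp (by fun_prop : Continuous fun s : ℝ => (s, y)))
    obtain ⟨M, hM⟩ := (isCompact_Icc (a := (0 : ℝ)) (b := T)).bddAbove_image hc.continuousOn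
    refine ⟨max M (g y), ?_⟩
    rintro _ ⟨⟨s, hs⟩, rfl⟩
    rcases le_total s T with hsT | hsT
    · exact le_max_of_le_left (hM ⟨s, ⟨hs, hsT⟩, rfl⟩)
    · exact le_max_of_le_right (hdecr s hsT y)
  have hle (y : X) {s : ℝ} (hs : 0 ≤ s) : g (ψ s y) ≤ ⨆ s : Set.Ici (0 : ℝ), g (ψ s y) :=
    le_ciSup (hbdd y) ⟨s, hs⟩
  have hle_self (y : X) : g y ≤ ⨆ s : Set.Ici (0 : ℝ), g (ψ s y) := by
    simpa only [h0] using hle y le_rfl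
  obtain ⟨C, hC⟩ := hLip T hT
  refine ⟨fun y => ⨆ s : Set.Ici (0 : ℝ), g (ψ s y), ⟨C + 1, ?_⟩, ?_, hle_self, ?_⟩
  · refine LipschitzWith.of_le_add_mul _ fun y z => ciSup_le ?_
    rintro ⟨s, hs⟩
    have hd : 0 ≤ dist y z := dist_nonneg
    have hCd : 0 ≤ C * dist y z := mul_nonneg C.2 hd
    push_cast
    rcases le_total s T with hsT | hsT
    · have h₁ := hg.le_add_mul (ψ s y) (ψ s z)
      have h₂ := (hC s ⟨hs, hsT⟩).dist_le_mul y z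
      have h₃ := hle z hs
      simp only [NNReal.coe_one, one_mul] at h₁
      linarith
    · have h₁ := hg.le_add_mul y z
      have h₂ := hdecr s hsT y
      have h₃ := hle_self z
      simp only [NNReal.coe_one, one_mul] at h₁
      linarith
  · refine fun t ht y => ciSup_le fun s => ?_
    rw [← hadd]
    exact hle y (add_nonneg s.2 ht)
  · exact fun y r h => ciSup_le fun s => h s s.2

theorem exists_lipschitz_lyapunov_of_not_SCR {X : Type*} [MetricSpace X]
    (ψ : ℝ → X → X) (hψ : IsFlow ψ) (hLipFlow : UniformlyLipschitzTimeMaps ψ) (x : X)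
    (hx : ¬ StronglyChainRecurrentPt ψ x) :
    ∃ h : X → ℝ, (∃ K : NNReal, LipschitzWith K h) ∧ IsLyapunov ψ h ∧
      x ∉ NeutralSet ψ h := by
  simp only [StronglyChainRecurrentPt, not_forall] at hx
  obtain ⟨ε, hε, T, hT, hx⟩ := hx
  have hpos : 0 < chainCost ψ T x x := by
    by_contra hneg
    obtain ⟨δ, hδ, hlt⟩ := exists_lt_of_csInf_lt nonempty_chainCost
      ((not_lt.1 hneg).trans_lt hε)
    obtain ⟨n, y, t, hn, ht, ha, hb, hsum⟩ := hδ
    exact hx ⟨n, y, t, hn, ht, ha, hb, hsum.trans hlt⟩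
  obtain ⟨h, hLip, hLyap, hge, hle⟩ := exists_lipschitz_lyapunov_of_eventually_nonincreasing
    hψ hLipFlow hT lipschitzWith_chainCost (g := chainCost ψ T x)
    fun t ht y => chainCost_flow_le ht
  refine ⟨h, hLip, hLyap, fun hmem => ?_⟩
  have h₁ : h (ψ T x) ≤ 0 := hle _ _ fun t ht => by
    rw [← hψ.2.2]
    exact chainCost_self_flow (le_add_of_nonneg_left ht)
  have h₂ := hge x
  rw [hmem T] at h₁
  linarith
end

section
/- Let ψ be a flow on a metric space (X,d) such that ψ_t is Lipschitz continuous for every t ≥ 0, uniformly for t in compact subsets of [0,+∞). Then ψ is strongly chain transitive if and only if every Lipschitz continuous Lyapunov function for ψ is constant. -/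
/-- `StrongChainCost ψ T a b c` says that some chain from `a` to `b`, all of whose times are at
least `T`, has total jump length `c`. -/
inductive StrongChainCost {X : Type*} [MetricSpace X] (ψ : ℝ → X → X) (T : ℝ) (a : X) :
    X → ℝ → Prop
  | single (t : ℝ) (ht : T ≤ t) (b : X) : StrongChainCost ψ T a b (dist (ψ t a) b)
  | snoc (b : X) (c : ℝ) (hc : StrongChainCost ψ T a b c) (t : ℝ) (ht : T ≤ t) (b' : X) :
      StrongChainCost ψ T a b' (c + dist (ψ t b) b')

namespace StrongChainCost

variable {X : Type*} [MetricSpace X] {ψ : ℝ → X → X} {T : ℝ} {a b : X} {c : ℝ}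

lemma nonneg (h : StrongChainCost ψ T a b c) : 0 ≤ c := by
  induction h with
  | single t ht b => exact dist_nonneg
  | snoc b c hc t ht b' ih => exact add_nonneg ih dist_nonneg

lemma exists_fin_chain (h : StrongChainCost ψ T a b c) :
    ∃ (n : ℕ) (x : Fin (n + 1) → X) (t : Fin n → ℝ), 0 < n ∧ (∀ i, T ≤ t i) ∧
      x 0 = a ∧ x (Fin.last n) = b ∧
      (∑ i : Fin n, dist (ψ (t i) (x i.castSucc)) (x i.succ)) = c := by
  induction h with
  | single t ht b => exact ⟨1, ![a, b], ![t], one_pos, by simpa using ht, rfl, rfl, by simp⟩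
  | snoc b c hc t ht b' ih =>
    obtain ⟨n, x, s, hn, hs, h0, hl, hsum⟩ := ih
    refine ⟨n + 1, Fin.snoc x b', Fin.snoc s t, n.succ_pos, ?_, ?_, ?_, ?_⟩
    · intro i
      refine Fin.lastCases ?_ (fun j => ?_) i
      · simpa using ht
      · simpa using hs j
    · rw [← Fin.castSucc_zero, Fin.snoc_castSucc, h0]
    · simp
    · rw [Fin.sum_univ_castSucc]
      simp only [Fin.snoc_castSucc, Fin.snoc_last, Fin.succ_castSucc, Fin.succ_last, hl, hsum]

lemma hasStrongChain {ε : ℝ} (h : StrongChainCost ψ T a b c) (hc : c < ε) :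
    HasStrongChain ψ ε T a b := by
  obtain ⟨n, x, t, hn, ht, h0, hl, hsum⟩ := h.exists_fin_chain
  exact ⟨n, x, t, hn, ht, h0, hl, hsum ▸ hc⟩

lemma exists_le_add_dist (h : StrongChainCost ψ T a b c) (b' : X) :
    ∃ c' ≤ c + dist b b', StrongChainCost ψ T a b' c' := by
  cases h with
  | single t ht b => exact ⟨_, dist_triangle _ _ _, .single t ht b'⟩
  | snoc b₀ c₀ hc t ht b =>
    refine ⟨_, ?_, .snoc b₀ c₀ hc t ht b'⟩
    linarith [dist_triangle (ψ t b₀) b b']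

lemma exists_le_mul (hψ : IsFlow ψ) (h : StrongChainCost ψ T a b c) {s : ℝ} (hs : 0 ≤ s)
    {C : NNReal} (hC : 1 ≤ C) (hLip : LipschitzWith C (ψ s)) :
    ∃ c' ≤ C * c, StrongChainCost ψ T a (ψ s b) c' := by
  have hC' : (1 : ℝ) ≤ C := by exact_mod_cast hC
  cases h with
  | single t ht b =>
    refine ⟨_, ?_, .single (s + t) (by linarith) _⟩
    rw [hψ.2.2]
    exact hLip.dist_le_mul _ _
  | snoc b₀ c₀ hc t ht b =>
    refine ⟨_, ?_, .snoc b₀ c₀ hc (s + t) (by linarith) _⟩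
    rw [hψ.2.2]
    nlinarith [hLip.dist_le_mul (ψ t b₀) b, hc.nonneg]

end StrongChainCost

/-- The infimum of the total jump lengths of the chains from `a` to `b` with times at
least `T`. -/
noncomputable def strongChainInf {X : Type*} [MetricSpace X] (ψ : ℝ → X → X) (T : ℝ)
    (a b : X) : ℝ :=
  sInf {c | StrongChainCost ψ T a b c}

section strongChainInf

variable {X : Type*} [MetricSpace X] {ψ : ℝ → X → X} {T : ℝ}

lemma strongChainInf_le {a b : X} {c : ℝ} (h : StrongChainCost ψ T a b c) :
    strongChainInf ψ T a b ≤ c :=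
  csInf_le ⟨0, fun _ h => h.nonneg⟩ h

lemma le_strongChainInf {a b : X} {r : ℝ} (h : ∀ c, StrongChainCost ψ T a b c → r ≤ c) :
    r ≤ strongChainInf ψ T a b :=
  le_csInf ⟨_, .single T le_rfl b⟩ h

lemma exists_cost_lt_of_strongChainInf_lt {a b : X} {ε : ℝ} (h : strongChainInf ψ T a b < ε) :
    ∃ c < ε, StrongChainCost ψ T a b c := by
  obtain ⟨c, hc, hlt⟩ := exists_lt_of_csInf_lt ⟨_, .single T le_rfl b⟩ h
  exact ⟨c, hlt, hc⟩

lemma strongChainInf_nonneg (a b : X) : 0 ≤ strongChainInf ψ T a b :=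
  le_strongChainInf fun _ h => h.nonneg

lemma strongChainInf_flow_self (a : X) : strongChainInf ψ T a (ψ T a) = 0 :=
  le_antisymm (by simpa using strongChainInf_le (ψ := ψ) (a := a) (.single T le_rfl (ψ T a)))
    (strongChainInf_nonneg _ _)

lemma strongChainInf_le_add_dist (a b b' : X) :
    strongChainInf ψ T a b' ≤ strongChainInf ψ T a b + dist b b' := by
  rw [← sub_le_iff_le_add]
  refine le_strongChainInf fun c hc => ?_
  obtain ⟨c', hle, hc'⟩ := hc.exists_le_add_dist b'
  linarith [strongChainInf_le hc']

lemma strongChainInf_flow_le {s : ℝ} (hs : T ≤ s) (a b : X) :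
    strongChainInf ψ T a (ψ s b) ≤ strongChainInf ψ T a b :=
  le_strongChainInf fun c hc => by
    simpa using strongChainInf_le (.snoc b c hc s hs (ψ s b))

lemma strongChainInf_flow_le_mul (hψ : IsFlow ψ) {s : ℝ} (hs : 0 ≤ s) {C : NNReal}
    (hC : 1 ≤ C) (hLip : LipschitzWith C (ψ s)) (a b : X) :
    strongChainInf ψ T a (ψ s b) ≤ C * strongChainInf ψ T a b := by
  have hC' : (0 : ℝ) < C := by exact_mod_cast one_pos.trans_le hC
  rw [← div_le_iff₀' hC']
  refine le_strongChainInf fun c hc => ?_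
  obtain ⟨c', hle, hc'⟩ := hc.exists_le_mul hψ hs hC hLip
  rw [div_le_iff₀' hC']
  exact (strongChainInf_le hc').trans hle

end strongChainInf

lemma UniformlyLipschitzTimeMaps.exists_one_le {X : Type*} [MetricSpace X] {ψ : ℝ → X → X}
    (h : UniformlyLipschitzTimeMaps ψ) {T : ℝ} (hT : 0 ≤ T) :
    ∃ C : NNReal, 1 ≤ C ∧ ∀ t ∈ Set.Icc 0 T, LipschitzWith C (ψ t) := by
  obtain ⟨C, hC⟩ := h T hT
  exact ⟨max 1 C, le_max_left _ _, fun t ht => (hC t ht).weaken (le_max_right _ _)⟩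

/-- Taking the supremum of `strongChainInf` along forward orbits gives a Lipschitz Lyapunov
function comparable to `strongChainInf`. -/
lemma exists_lipschitz_lyapunov_comparable {X : Type*} [MetricSpace X] {ψ : ℝ → X → X}
    (hψ : IsFlow ψ) (hLip : UniformlyLipschitzTimeMaps ψ) {T : ℝ} (hT : 0 ≤ T) (a : X) :
    ∃ (h : X → ℝ) (C : NNReal), LipschitzWith C h ∧ IsLyapunov ψ h ∧
      ∀ b, strongChainInf ψ T a b ≤ h b ∧ h b ≤ C * strongChainInf ψ T a b := by
  obtain ⟨C, hC1, hC⟩ := hLip.exists_one_le hT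
  have hC1' : (1 : ℝ) ≤ C := by exact_mod_cast hC1
  have hbound (s : Set.Ici (0 : ℝ)) (b : X) :
      strongChainInf ψ T a (ψ s b) ≤ C * strongChainInf ψ T a b := by
    rcases le_total (s : ℝ) T with hs | hs
    · exact strongChainInf_flow_le_mul hψ s.2 hC1 (hC s ⟨s.2, hs⟩) a b
    · exact (strongChainInf_flow_le hs a b).trans
        (le_mul_of_one_le_left (strongChainInf_nonneg a b) hC1')
  let h : X → ℝ := fun b => ⨆ s : Set.Ici (0 : ℝ), strongChainInf ψ T a (ψ s b)
  have hle_h (s : ℝ) (hs : 0 ≤ s) (b : X) : strongChainInf ψ T a (ψ s b) ≤ h b :=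
    le_ciSup (f := fun s : Set.Ici (0 : ℝ) => strongChainInf ψ T a (ψ s b))
      ⟨_, Set.forall_mem_range.2 fun s => hbound s b⟩ ⟨s, hs⟩
  have hle_h_zero (b : X) : strongChainInf ψ T a b ≤ h b := by
    simpa [hψ.2.1] using hle_h 0 le_rfl b
  refine ⟨h, C, LipschitzWith.of_le_add_mul C fun b b' => ciSup_le fun s => ?_, ?_,
    fun b => ⟨hle_h_zero b, ciSup_le fun s => hbound s b⟩⟩
  · rcases le_total (s : ℝ) T with hs | hs
    · have h1 := strongChainInf_le_add_dist (ψ := ψ) (T := T) a (ψ s b') (ψ s b)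
      have h2 := (hC s ⟨s.2, hs⟩).dist_le_mul b' b
      rw [dist_comm b' b] at h2
      linarith [hle_h s s.2 b']
    · have h1 := strongChainInf_le_add_dist (ψ := ψ) (T := T) a b' b
      rw [dist_comm b' b] at h1
      linarith [strongChainInf_flow_le (ψ := ψ) hs a b, hle_h_zero b',
        le_mul_of_one_le_left (dist_nonneg (x := b) (y := b')) hC1']
  · intro t ht b
    refine ciSup_le fun s => ?_
    rw [← hψ.2.2]
    exact hle_h _ (add_nonneg s.2 ht) b

lemma IsLyapunov.le_add_mul_sum_dist {X : Type*} [MetricSpace X] {ψ : ℝ → X → X} {h : X → ℝ}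
    (hL : IsLyapunov ψ h) {K : NNReal} (hK : LipschitzWith K h) (n : ℕ)
    (x : Fin (n + 1) → X) (t : Fin n → ℝ) (ht : ∀ i, 0 ≤ t i) :
    h (x (Fin.last n)) ≤
      h (x 0) + K * ∑ i : Fin n, dist (ψ (t i) (x i.castSucc)) (x i.succ) := by
  induction n with
  | zero => simp
  | succ n ih =>
    have h1 := ih (fun i => x i.castSucc) (fun i => t i.castSucc) fun i => ht _
    have h2 := hL (t (Fin.last n)) (ht _) (x (Fin.last n).castSucc)
    have h3 := hK.le_add_mul (x (Fin.last (n + 1)))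
      (ψ (t (Fin.last n)) (x (Fin.last n).castSucc))
    rw [dist_comm] at h3
    rw [Fin.sum_univ_castSucc, mul_add]
    simp only [Fin.succ_last, Fin.succ_castSucc, Fin.castSucc_zero] at h1 h3 ⊢
    linarith

lemma StronglyChainTransitive.lyapunov_le {X : Type*} [MetricSpace X] {ψ : ℝ → X → X}
    (hS : StronglyChainTransitive ψ) {h : X → ℝ} {K : NNReal} (hK : LipschitzWith K h)
    (hL : IsLyapunov ψ h) (x y : X) : h y ≤ h x := by
  refine le_of_forall_pos_le_add fun ε hε => ?_
  have hK1 : (0 : ℝ) < K + 1 := by positivity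
  obtain ⟨n, z, t, -, ht, rfl, rfl, hsum⟩ := hS x y (ε / (K + 1)) (by positivity) 0 le_rfl
  rw [lt_div_iff₀ hK1] at hsum
  have hnn : 0 ≤ ∑ i : Fin n, dist (ψ (t i) (z i.castSucc)) (z i.succ) :=
    Finset.sum_nonneg fun _ _ => dist_nonneg
  linarith [hL.le_add_mul_sum_dist hK n z t ht]

theorem SCT_iff_lipschitz_lyapunov_constant {X : Type*} [MetricSpace X]
    (ψ : ℝ → X → X) (hψ : IsFlow ψ) (hLipFlow : UniformlyLipschitzTimeMaps ψ) :
    StronglyChainTransitive ψ ↔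
      ∀ h : X → ℝ, (∃ K : NNReal, LipschitzWith K h) → IsLyapunov ψ h →
        ∀ x y : X, h x = h y := by
  refine ⟨fun hS h ⟨K, hK⟩ hL x y =>
    le_antisymm (hS.lyapunov_le hK hL y x) (hS.lyapunov_le hK hL x y), ?_⟩
  intro hconst x y ε hε T hT
  obtain ⟨h, C, hC, hL, hcomp⟩ := exists_lipschitz_lyapunov_comparable hψ hLipFlow hT x
  have hzero : h (ψ T x) ≤ 0 := by
    simpa [strongChainInf_flow_self] using (hcomp (ψ T x)).2
  have hlt : strongChainInf ψ T x y < ε := by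
    linarith [(hcomp y).1, hconst h ⟨C, hC⟩ hL y (ψ T x)]
  obtain ⟨c, hc, hchain⟩ := exists_cost_lt_of_strongChainInf_lt hlt
  exact hchain.hasStrongChain hc
end

section
/- Let ψ be a flow on a compact metric space (X,d) which preserves a Borel probability measure μ that is positive on every non-empty open subset of X, and suppose ψ is ergodic with respect to μ (every Borel set A ⊆ X with ψ_t(A) = A for all t ∈ ℝ satisfies μ(A) = 0 or μ(A) = 1). Then every continuous Lyapunov function for ψ is constant; in particular, ψ is strongly chain transitive. -/
open MeasureTheory

/-- A continuous function which does not increase along all sufficiently long forward orbit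
segments of a measure-preserving flow is a first integral, provided the measure has full support. -/
theorem IsFlow.isFirstIntegral_of_eventually_le {X : Type*} [MetricSpace X] [CompactSpace X]
    [MeasurableSpace X] [BorelSpace X] {ψ : ℝ → X → X} (hψ : IsFlow ψ) (μ : Measure X)
    [IsFiniteMeasure μ] [μ.IsOpenPosMeasure] (hpres : ∀ t, MeasurePreserving (ψ t) μ μ)
    {h : X → ℝ} (hc : Continuous h) {T : ℝ} (hT : ∀ t ≥ T, ∀ x, h (ψ t x) ≤ h x) :
    IsFirstIntegral ψ h := by
  have hψc (t : ℝ) : Continuous (ψ t) := hψ.1.comp (Continuous.prodMk_right t)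
  have key : ∀ t ≥ T, ∀ x, h (ψ t x) = h x := by
    intro t ht
    have hint {f : X → ℝ} (hf : Continuous f) : Integrable f μ :=
      hf.integrable_of_hasCompactSupport (HasCompactSupport.of_compactSpace f)
    have hct : Continuous fun x => h (ψ t x) := hc.comp (hψc t)
    have hI : ∫ x, h (ψ t x) ∂μ = ∫ x, h x ∂μ := by
      rw [← integral_map (hψc t).aemeasurable hc.aestronglyMeasurable, (hpres t).map_eq]
    have hae := (integral_eq_iff_of_ae_le (hint hct) (hint hc)
      (Filter.Eventually.of_forall (hT t ht))).1 hI
    exact congrFun ((hct.ae_eq_iff_eq μ hc).1 hae)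
  intro t x
  have h₁ := key (max T (T - t)) (le_max_left _ _) (ψ t x)
  rw [← hψ.2.2] at h₁
  rw [← h₁]
  exact key _ (by linarith [le_max_right T (T - t)]) x

/-- A continuous first integral of an ergodic flow is constant if the measure has full support. -/
theorem IsFirstIntegral.eq_of_ergodic {X : Type*} [MetricSpace X]
    [MeasurableSpace X] [BorelSpace X] {ψ : ℝ → X → X} (hψ : IsFlow ψ) (μ : Measure X)
    [IsProbabilityMeasure μ] [μ.IsOpenPosMeasure]
    (hergodic : ∀ A : Set X, MeasurableSet A → (∀ t : ℝ, ψ t '' A = A) → μ A = 0 ∨ μ A = 1)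
    {h : X → ℝ} (hc : Continuous h) (hh : IsFirstIntegral ψ h) (x y : X) : h x = h y := by
  suffices H : ∀ x y, ¬ h x < h y from le_antisymm (not_lt.1 (H y x)) (not_lt.1 (H x y))
  intro x y hxy
  obtain ⟨c, hxc, hcy⟩ := exists_between hxy
  have hlt : IsOpen {z | h z < c} := isOpen_lt hc continuous_const
  have hgt : IsOpen {z | c < h z} := isOpen_lt continuous_const hc
  have hinv : ∀ t : ℝ, ψ t '' {z | h z < c} = {z | h z < c} := by
    intro t
    ext z
    constructor
    · rintro ⟨w, hw, rfl⟩
      simpa only [Set.mem_ofPred_eq, hh t w] using hw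
    · intro hz
      refine ⟨ψ (-t) z, ?_, ?_⟩
      · simpa only [Set.mem_ofPred_eq, hh (-t) z] using hz
      · rw [← hψ.2.2, add_neg_cancel, hψ.2.1]
  rcases hergodic _ hlt.measurableSet hinv with h0 | h1
  · exact (hlt.measure_pos μ ⟨x, hxc⟩).ne' h0
  · refine (hgt.measure_pos μ ⟨y, hcy⟩).ne' (measure_mono_null ?_
      ((prob_compl_eq_zero_iff hlt.measurableSet).2 h1))
    intro z hz
    simp only [Set.mem_compl_iff, Set.mem_ofPred_eq, not_lt] at hz ⊢
    exact hz.le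

namespace HasStrongChain

variable {X : Type*} [MetricSpace X] {ψ : ℝ → X → X} {ε T : ℝ} {a b : X}

theorem pos_s12 (h : HasStrongChain ψ ε T a b) : 0 < ε := by
  obtain ⟨n, x, t, -, -, -, -, hs⟩ := h
  exact (Finset.sum_nonneg fun i _ => dist_nonneg).trans_lt hs

theorem mono {δ : ℝ} (h : HasStrongChain ψ ε T a b) (hεδ : ε ≤ δ) :
    HasStrongChain ψ δ T a b := by
  obtain ⟨n, x, t, hn, ht, h0, hl, hs⟩ := h
  exact ⟨n, x, t, hn, ht, h0, hl, hs.trans_le hεδ⟩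

theorem of_dist_lt {t : ℝ} (ht : T ≤ t) (h : dist (ψ t a) b < ε) :
    HasStrongChain ψ ε T a b :=
  ⟨1, ![a, b], fun _ => t, one_pos, fun _ => ht, rfl, rfl, by simpa using h⟩

theorem flow_right {t : ℝ} (h : HasStrongChain ψ ε T a b) (ht : T ≤ t) :
    HasStrongChain ψ ε T a (ψ t b) := by
  obtain ⟨n, x, s, hn, hs, h0, hl, hsum⟩ := h
  refine ⟨n + 1, Fin.snoc (α := fun _ => X) x (ψ t b), Fin.snoc (α := fun _ => ℝ) s t,
    n.succ_pos, ?_, ?_, ?_, ?_⟩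
  · refine Fin.lastCases ?_ fun i => ?_
    · simpa using ht
    · simpa using hs i
  · rw [← Fin.castSucc_zero, Fin.snoc_castSucc, h0]
  · rw [Fin.snoc_last]
  · rw [Fin.sum_univ_castSucc]
    simpa only [Fin.snoc_castSucc, Fin.snoc_last, Fin.succ_castSucc, Fin.succ_last, hl, dist_self,
      add_zero] using hsum

theorem add_dist (h : HasStrongChain ψ ε T a b) (c : X) :
    HasStrongChain ψ (ε + dist b c) T a c := by
  obtain ⟨_ | n, x, s, hn, hs, h0, hl, hsum⟩ := h
  · exact absurd hn (lt_irrefl 0)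
  refine ⟨n + 1, Fin.snoc (α := fun _ => X) (fun i : Fin (n + 1) => x i.castSucc) c, s, hn, hs,
    ?_, ?_, ?_⟩
  · rw [← Fin.castSucc_zero, Fin.snoc_castSucc, Fin.castSucc_zero, h0]
  · rw [Fin.snoc_last]
  · rw [Fin.sum_univ_castSucc] at hsum ⊢
    simp only [Fin.snoc_castSucc, Fin.snoc_last, Fin.succ_castSucc, Fin.succ_last] at hsum ⊢
    rw [hl] at hsum
    linarith [dist_triangle (ψ (s (Fin.last n)) (x (Fin.last n).castSucc)) b c]

end HasStrongChain

/-- The infimal total jump size of the strong chains from `a` to `b` whose times are all at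
least `T`. -/
noncomputable def strongChainCost {X : Type*} [MetricSpace X] (ψ : ℝ → X → X) (T : ℝ) (a b : X) :
    ℝ :=
  sInf {ε | HasStrongChain ψ ε T a b}

section strongChainCost

variable {X : Type*} [MetricSpace X] {ψ : ℝ → X → X} {ε T : ℝ} {a b : X}

theorem strongChainCost_le (h : HasStrongChain ψ ε T a b) : strongChainCost ψ T a b ≤ ε :=
  csInf_le ⟨0, fun _ h => h.pos_s12.le⟩ h

theorem hasStrongChain_of_cost_lt (h : strongChainCost ψ T a b < ε) :
    HasStrongChain ψ ε T a b := by
  obtain ⟨δ, hδ, hδε⟩ := exists_lt_of_csInf_lt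
    ⟨dist (ψ T a) b + 1, HasStrongChain.of_dist_lt le_rfl (lt_add_one _)⟩ h
  exact HasStrongChain.mono hδ hδε.le

theorem continuous_strongChainCost (ψ : ℝ → X → X) (T : ℝ) (a : X) :
    Continuous (strongChainCost ψ T a) := by
  refine (LipschitzWith.of_le_add fun x y => ?_).continuous
  refine le_of_forall_pos_le_add fun η hη => ?_
  have h := strongChainCost_le ((hasStrongChain_of_cost_lt
    (lt_add_of_pos_right (strongChainCost ψ T a y) hη)).add_dist x)
  rw [dist_comm y x] at h
  linarith

theorem strongChainCost_flow_le {t : ℝ} (ht : T ≤ t) (a b : X) :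
    strongChainCost ψ T a (ψ t b) ≤ strongChainCost ψ T a b :=
  le_of_forall_pos_le_add fun _ hη => strongChainCost_le
    ((hasStrongChain_of_cost_lt (lt_add_of_pos_right _ hη)).flow_right ht)

theorem strongChainCost_flow_self_nonpos (ψ : ℝ → X → X) (T : ℝ) (a : X) :
    strongChainCost ψ T a (ψ T a) ≤ 0 :=
  le_of_forall_pos_le_add fun η hη => strongChainCost_le
    (HasStrongChain.of_dist_lt le_rfl (by simpa using hη))

end strongChainCost

theorem continuous_lyapunov_constant_of_ergodic {X : Type*} [MetricSpace X]
    [CompactSpace X] [MeasurableSpace X] [BorelSpace X]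
    (ψ : ℝ → X → X) (hψ : IsFlow ψ) (μ : Measure X) [IsProbabilityMeasure μ]
    (hpos : ∀ U : Set X, IsOpen U → U.Nonempty → 0 < μ U)
    (hpres : ∀ (t : ℝ) (A : Set X), MeasurableSet A → μ (ψ t ⁻¹' A) = μ A)
    (hergodic : ∀ A : Set X, MeasurableSet A → (∀ t : ℝ, ψ t '' A = A) →
      μ A = 0 ∨ μ A = 1) :
    (∀ h : X → ℝ, Continuous h → IsLyapunov ψ h → ∀ x y : X, h x = h y) ∧
      StronglyChainTransitive ψ := by
  have : μ.IsOpenPosMeasure := ⟨fun U hU hne => (hpos U hU hne).ne'⟩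
  have hmp (t : ℝ) : MeasurePreserving (ψ t) μ μ := by
    have hm : Measurable (ψ t) := (hψ.1.comp (Continuous.prodMk_right t)).measurable
    exact ⟨hm, Measure.ext fun A hA => by rw [Measure.map_apply hm hA, hpres t A hA]⟩
  have const {h : X → ℝ} (hc : Continuous h) {T : ℝ} (hT : ∀ t ≥ T, ∀ x, h (ψ t x) ≤ h x)
      (x y : X) : h x = h y :=
    (hψ.isFirstIntegral_of_eventually_le μ hmp hc hT).eq_of_ergodic hψ μ hergodic hc x y
  refine ⟨fun h hc hh => const hc hh, fun x y ε hε T _ => hasStrongChain_of_cost_lt ?_⟩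
  rw [const (continuous_strongChainCost ψ T x)
    (fun t ht z => strongChainCost_flow_le ht x z) y (ψ T x)]
  exact (strongChainCost_flow_self_nonpos ψ T x).trans_lt hε
end
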